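/- (Verification of the Dutch auction) Let I be the Dutch-auction interpretation and let α be the mechanism 'p:=init; w:=0; while (p>0 ∧ w=0) do ( ch_{{1,2}}({x1,x2}); if x1>0 then w:=1 else (if x2>0 then w:=2 else p:=p−1) )', with postcondition Q the e-predicate (w=1 → o=(v1−p,0)) ∧ (w=2 → o=(0,v2−p)) ∧ (w=0 → o=(0,0)). Then I ⊢ {v1 ≥ v2 > 0 ∧ init ≥ v2 ∧ o=(v1−v2,0)} α {Q}; in particular, whenever v1 ≥ v2 > 0 and init ≥ v2, the Dutch auction has a subgame-perfect equilibrium in which player 1 obtains the object at price v2, yielding outcome (v1 − v2, 0). -/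

import Mathlib

open scoped Classical

noncomputable section

namespace MPL

/-- Terms over variables `V` and function symbols `F` (function symbols applied to
a stream of arguments; finite arities are modelled by ignoring superfluous arguments). -/
inductive Term (V F : Type) : Type where
  | var : V → Term V F
  | app : F → (ℕ → Term V F) → Term V F

/-- Boolean expressions over variables `V`, function symbols `F` and relation symbols `R`. -/
inductive BExp (V F R : Type) : Type where
  | tt : BExp V F R
  | rel : R → (ℕ → Term V F) → BExp V F R
  | not : BExp V F R → BExp V F R
  | and : BExp V F R → BExp V F R → BExp V F R

/-- MPL mechanisms: assignment, sequential composition, conditional, while-loop,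
and simultaneous choice `ch_A(X)` for a finite nonempty set `A` of agents with
distinct choice variables `X a` for `a ∈ A`. -/
inductive Mech (Ag V F R : Type) : Type where
  | assign : V → Term V F → Mech Ag V F R
  | seq : Mech Ag V F R → Mech Ag V F R → Mech Ag V F R
  | ite : BExp V F R → Mech Ag V F R → Mech Ag V F R → Mech Ag V F R
  | wh : BExp V F R → Mech Ag V F R → Mech Ag V F R
  | choice : (A : Finset Ag) → A.Nonempty → (X : Ag → V) → Set.InjOn X ↑A → Mech Ag V F R

/-- An interpretation: a domain, interpretations of the function and relation symbols,
and for every agent a preference preorder on the domain with a uniformly worst element. -/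
structure Interp (Ag V F R : Type) : Type 1 where
  D : Type
  funI : F → (ℕ → D) → D
  relI : R → (ℕ → D) → Prop
  /-- `pref a d d'` means `d ≥_a d'`. -/
  pref : Ag → D → D → Prop
  pref_refl : ∀ a d, pref a d d
  pref_trans : ∀ a d1 d2 d3, pref a d1 d2 → pref a d2 d3 → pref a d1 d3
  worst : D
  worst_least : ∀ a d, pref a d worst

variable {Ag V F R : Type}

/-- A state assigns a domain element to every mechanism variable. -/
abbrev State (I : Interp Ag V F R) : Type := V → I.D

/-- Value of a term in an interpretation at a state. -/
def Term.eval (I : Interp Ag V F R) (s : State I) : Term V F → I.D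
  | .var x => s x
  | .app f ts => I.funI f (fun n => (ts n).eval I s)

/-- Truth of a boolean expression in an interpretation at a state. -/
def BExp.holds (I : Interp Ag V F R) (s : State I) : BExp V F R → Prop
  | .tt => True
  | .rel r ts => I.relI r (fun n => (ts n).eval I s)
  | .not b => ¬ b.holds I s
  | .and b1 b2 => b1.holds I s ∧ b2.holds I s

/-- A configuration: a mechanism (or `none` for the empty mechanism Λ) together with a state. -/
abbrev Cfg (I : Interp Ag V F R) : Type := Option (Mech Ag V F R) × State I

/-- Update a state at one variable. -/
def updState (I : Interp Ag V F R) (s : State I) (x : V) (d : I.D) : State I :=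
  fun y => if y = x then d else s y

/-- The structured operational semantics: labelled transitions `⟨γ,s⟩ →_A ⟨γ',s'⟩`. -/
inductive Step (I : Interp Ag V F R) : Cfg I → Set Ag → Cfg I → Prop where
  | assign (x : V) (t : Term V F) (s : State I) :
      Step I (some (.assign x t), s) ∅ (none, updState I s x (t.eval I s))
  | choice (A : Finset Ag) (hA : A.Nonempty) (X : Ag → V) (hX : Set.InjOn X ↑A)
      (s s' : State I) (hagree : ∀ y : V, (∀ a ∈ A, X a ≠ y) → s' y = s y) :
      Step I (some (.choice A hA X hX), s) ↑A (none, s')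
  | seqFin {γ1 γ2 s L s'} : Step I (some γ1, s) L (none, s') →
      Step I (some (.seq γ1 γ2), s) L (some γ2, s')
  | seqStep {γ1 γ2 s L γ1' s'} : Step I (some γ1, s) L (some γ1', s') →
      Step I (some (.seq γ1 γ2), s) L (some (.seq γ1' γ2), s')
  | iteT {B γ1 γ2 s} : B.holds I s → Step I (some (.ite B γ1 γ2), s) ∅ (some γ1, s)
  | iteF {B γ1 γ2 s} : ¬ B.holds I s → Step I (some (.ite B γ1 γ2), s) ∅ (some γ2, s)
  | whF {B γ s} : ¬ B.holds I s → Step I (some (.wh B γ), s) ∅ (none, s)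
  | whT {B γ s} : B.holds I s → Step I (some (.wh B γ), s) ∅ (some (.seq γ (.wh B γ)), s)

/-- A (partial) history of the game rooted at `c0`: a nonempty finite sequence of
configurations starting at `c0` and linked by transitions. -/
def IsHist (I : Interp Ag V F R) (c0 : Cfg I) (h : List (Cfg I)) : Prop :=
  h.head? = some c0 ∧ h.Chain' (fun c c' => ∃ L, Step I c L c')

/-- A strategy profile: for every agent a strategy assigning a chosen value to each history. -/
abbrev Profile (I : Interp Ag V F R) : Type := Ag → List (Cfg I) → I.D

/-- The state resulting from the agents in `A` choosing values for their variables
`X a` according to the profile `σ` at history `h`. -/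
def chooseVal (I : Interp Ag V F R) (A : Finset Ag) (X : Ag → V) (σ : Profile I)
    (h : List (Cfg I)) (s : State I) : State I :=
  fun y => if hy : ∃ a, a ∈ A ∧ X a = y then σ hy.choose h else s y

/-- The successor configuration of a (non-empty) configuration, as determined by the
operational semantics together with the choices prescribed by the profile `σ` at history `h`. -/
def next (I : Interp Ag V F R) (σ : Profile I) (h : List (Cfg I)) :
    Mech Ag V F R → State I → Cfg I
  | .assign x t, s => (none, updState I s x (t.eval I s))
  | .choice A _ X _, s => (none, chooseVal I A X σ h s)
  | .seq γ1 γ2, s =>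
      match next I σ h γ1 s with
      | (none, s') => (some γ2, s')
      | (some γ1', s') => (some (.seq γ1' γ2), s')
  | .ite B γ1 γ2, s => if B.holds I s then (some γ1, s) else (some γ2, s)
  | .wh B γ, s => if B.holds I s then (some (.seq γ (.wh B γ)), s) else (none, s)

/-- Extend a history by one step of play according to `σ` (histories ending in Λ stay put). -/
def extend (I : Interp Ag V F R) (σ : Profile I) (h : List (Cfg I)) : List (Cfg I) :=
  match h.getLast? with
  | some (some γ, s) => h ++ [next I σ h γ s]
  | _ => h

/-- The history of the unique run determined by profile `σ` from `c0`, after `n` steps. -/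
def runH (I : Interp Ag V F R) (c0 : Cfg I) (σ : Profile I) : ℕ → List (Cfg I)
  | 0 => [c0]
  | n + 1 => extend I σ (runH I c0 σ n)

/-- A run: the (possibly infinite) sequence of configurations of a maximal play. -/
abbrev Run (I : Interp Ag V F R) : Type := ℕ → Option (Cfg I)

/-- The unique maximal run determined by profile `σ` from initial configuration `c0`. -/
def runOf (I : Interp Ag V F R) (c0 : Cfg I) (σ : Profile I) : Run I :=
  fun n => (runH I c0 σ n)[n]?

/-- `run(σ)` is finite (reaches the empty mechanism Λ). -/
def Terminates (I : Interp Ag V F R) (c0 : Cfg I) (σ : Profile I) : Prop :=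
  ∃ n, ∃ s : State I, (runH I c0 σ n).getLast? = some ((none : Option (Mech Ag V F R)), s)

/-- The final state `s_σ` of a finite run. -/
def finalState (I : Interp Ag V F R) {c0 : Cfg I} {σ : Profile I}
    (h : Terminates I c0 σ) : State I :=
  h.choose_spec.choose

/-- An outcome function assigns an element of the domain to every terminal history
(represented by the corresponding run). -/
abbrev OutcomeF (I : Interp Ag V F R) : Type := Run I → I.D

/-- An extended predicate (e-predicate): a set of pairs (state, outcome). -/
abbrev EPred (I : Interp Ag V F R) : Type := Set (State I × I.D)

/-- `ô ∈ Ô_Q`: every finite run is assigned an outcome satisfying `Q` at its final state. -/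
def memOhat (I : Interp Ag V F R) (c0 : Cfg I) (Q : EPred I) (oh : OutcomeF I) : Prop :=
  ∀ σ : Profile I, ∀ ht : Terminates I c0 σ, (finalState I ht, oh (runOf I c0 σ)) ∈ Q

/-- `σ` is a Nash equilibrium in the game rooted at `c0` with outcome function `oh`. -/
def NashEq (I : Interp Ag V F R) (c0 : Cfg I) (oh : OutcomeF I) (σ : Profile I) : Prop :=
  ∀ (i : Ag) (τ : Profile I), (∀ j, j ≠ i → τ j = σ j) →
    I.pref i (oh (runOf I c0 σ)) (oh (runOf I c0 τ))

/-- Prepend a finite sequence of configurations to a run. -/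
def prependRun (I : Interp Ag V F R) (l : List (Cfg I)) (ρ : Run I) : Run I :=
  fun n => if hn : n < l.length then some l[n] else ρ (n - l.length)

/-- Restriction of an outcome function to the subgame reached via history `h`. -/
def restrictO (I : Interp Ag V F R) (h : List (Cfg I)) (oh : OutcomeF I) : OutcomeF I :=
  fun ρ => oh (prependRun I h.dropLast ρ)

/-- Restriction of a strategy profile to the subgame reached via history `h`. -/
def restrictP (I : Interp Ag V F R) (h : List (Cfg I)) (σ : Profile I) : Profile I :=
  fun a h' => σ a (h.dropLast ++ h')

/-- `σ` is a subgame-perfect equilibrium in `G(γ,s,I,oh)`: its restriction to every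
subgame (rooted at any configuration reachable from `⟨γ,s⟩`) is a Nash equilibrium there. -/
def SPE (I : Interp Ag V F R) (γ : Mech Ag V F R) (s : State I)
    (oh : OutcomeF I) (σ : Profile I) : Prop :=
  ∀ (h : List (Cfg I)) (c : Cfg I), IsHist I (some γ, s) h → h.getLast? = some c →
    NashEq I c (restrictO I h oh) (restrictP I h σ)

/-- The correctness assertion `I ⊨ {P} γ {Q}`. -/
def Valid (I : Interp Ag V F R) (P : EPred I) (γ : Mech Ag V F R) (Q : EPred I) : Prop :=
  ∀ so ∈ P, ∃ (oh : OutcomeF I) (σ : Profile I),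
    memOhat I (some γ, so.1) Q oh ∧ SPE I γ so.1 oh σ ∧ oh (runOf I (some γ, so.1) σ) = so.2

/-- The weakest precondition `wpre(γ,Q,I)`. -/
def wpre (I : Interp Ag V F R) (γ : Mech Ag V F R) (Q : EPred I) : EPred I :=
  {so | ∃ (oh : OutcomeF I) (σ : Profile I),
    memOhat I (some γ, so.1) Q oh ∧ SPE I γ so.1 oh σ ∧ oh (runOf I (some γ, so.1) σ) = so.2}

/-- The substituted e-predicate `Q[x/t]`. -/
def substPred (I : Interp Ag V F R) (Q : EPred I) (x : V) (t : Term V F) : EPred I :=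
  {so | (updState I so.1 x (t.eval I so.1), so.2) ∈ Q}

/-- `B^I ∩ P`. -/
def gate (I : Interp Ag V F R) (B : BExp V F R) (P : EPred I) : EPred I :=
  {so | so ∈ P ∧ B.holds I so.1}

/-- `(¬B)^I ∩ P`. -/
def gateN (I : Interp Ag V F R) (B : BExp V F R) (P : EPred I) : EPred I :=
  {so | so ∈ P ∧ ¬ B.holds I so.1}

/-- The Hoare-style calculus for mechanisms: `I ⊢ {P} γ {Q}`. -/
inductive Deriv (I : Interp Ag V F R) : EPred I → Mech Ag V F R → EPred I → Prop where
  | assign (Q : EPred I) (x : V) (t : Term V F) :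
      Deriv I (substPred I Q x t) (.assign x t) Q
  | choice (A : Finset Ag) (hA : A.Nonempty) (X : Ag → V) (hX : Set.InjOn X ↑A)
      (Q : EPred I) :
      Deriv I (wpre I (.choice A hA X hX) Q) (.choice A hA X hX) Q
  | comp {P R' Q : EPred I} {γ1 γ2 : Mech Ag V F R} :
      Deriv I P γ1 R' → Deriv I R' γ2 Q → Deriv I P (.seq γ1 γ2) Q
  | ifR {P Q : EPred I} {B : BExp V F R} {γ1 γ2 : Mech Ag V F R} :
      Deriv I (gate I B P) γ1 Q → Deriv I (gateN I B P) γ2 Q →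
      Deriv I P (.ite B γ1 γ2) Q
  | whileR {P : EPred I} {B : BExp V F R} {γ : Mech Ag V F R} :
      Deriv I (gate I B P) γ P → Deriv I P (.wh B γ) (gateN I B P)
  | conseq {P P' Q Q' : EPred I} {γ : Mech Ag V F R} :
      P ⊆ P' → Deriv I P' γ Q' → Q' ⊆ Q → Deriv I P γ Q

/-- The Nash-equilibrium variant of validity. -/
def NashValid (I : Interp Ag V F R) (P : EPred I) (γ : Mech Ag V F R) (Q : EPred I) : Prop :=
  ∀ so ∈ P, ∃ (oh : OutcomeF I) (σ : Profile I),
    memOhat I (some γ, so.1) Q oh ∧ NashEq I (some γ, so.1) oh σ ∧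
    oh (runOf I (some γ, so.1) σ) = so.2

/-- Mechanisms without any `ch_A` construct, i.e. ordinary programs (MPL(PRG)). -/
def ChoiceFree : Mech Ag V F R → Prop
  | .assign _ _ => True
  | .seq γ1 γ2 => ChoiceFree γ1 ∧ ChoiceFree γ2
  | .ite _ γ1 γ2 => ChoiceFree γ1 ∧ ChoiceFree γ2
  | .wh _ γ => ChoiceFree γ
  | .choice _ _ _ _ => False

/-- Standard Hoare partial correctness: every finite maximal execution of `γ`
from a state in `P` terminates in a state in `Q`. -/
def HoarePartial (I : Interp Ag V F R) (P : Set (State I)) (γ : Mech Ag V F R)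
    (Q : Set (State I)) : Prop :=
  ∀ s ∈ P, ∀ (h : List (Cfg I)) (t : State I),
    IsHist I (some γ, s) h → h.getLast? = some ((none : Option (Mech Ag V F R)), t) → t ∈ Q

end MPL

namespace MPL

/-- The domain of the Dutch-auction interpretation: the integers, all pairs of
integers, and a uniformly worst element. -/
inductive DutD : Type where
  | int : ℤ → DutD
  | pair : ℤ → ℤ → DutD
  | bot : DutD

/-- Mechanism variables for the Dutch auction: the price `p`, the winner `w`,
and the choice variables `x1`, `x2`. -/
inductive DutV : Type where
  | p | w | x1 | x2
deriving DecidableEq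

/-- Function symbols: the constants `init`, 0, 1, 2 and the predecessor (for `p − 1`). -/
inductive DutF : Type where
  | cinit | c0 | c1 | c2 | pred
deriving DecidableEq

/-- Relation symbols: `pos t` means `t > 0`; `zero t` means `t = 0`. -/
inductive DutR : Type where
  | pos | zero
deriving DecidableEq

/-- The agents: players 1 and 2. -/
abbrev DutAg : Type := Fin 2

/-- The `i`-th component of a pair of integers (player `i`'s payoff at an outcome). -/
def dutProj (i : DutAg) : DutD → ℤ
  | .int n => n
  | .pair a b => if i = 0 then a else b
  | .bot => 0

/-- Player `i`'s preference: `d ≥_i d'` iff `d'` is the worst element, or neither is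
worst and the `i`-th component of `d` is at least that of `d'`. -/
def dutPref (i : DutAg) (d d' : DutD) : Prop :=
  d' = DutD.bot ∨ (d ≠ DutD.bot ∧ dutProj i d' ≤ dutProj i d)

/-- The Dutch-auction interpretation with initial price `init`. -/
def dutInterp (init : ℕ) : Interp DutAg DutV DutF DutR where
  D := DutD
  funI f args := match f with
    | .cinit => DutD.int init
    | .c0 => DutD.int 0
    | .c1 => DutD.int 1
    | .c2 => DutD.int 2
    | .pred => match args 0 with
        | DutD.int n => DutD.int (n - 1)
        | _ => DutD.bot
  relI r args := match r with
    | .pos => ∃ n : ℤ, args 0 = DutD.int n ∧ 0 < n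
    | .zero => args 0 = DutD.int 0
  pref := dutPref
  pref_refl := by
    intro a d
    by_cases h : d = DutD.bot
    · exact Or.inl h
    · exact Or.inr ⟨h, le_refl _⟩
  pref_trans := by
    intro a d1 d2 d3 h12 h23
    rcases h23 with h | ⟨h2ne, hle23⟩
    · exact Or.inl h
    · rcases h12 with h | ⟨h1ne, hle12⟩
      · exact absurd h h2ne
      · exact Or.inr ⟨h1ne, le_trans hle23 hle12⟩
  worst := DutD.bot
  worst_least := fun _ _ => Or.inl rfl

/-- The boolean expression `x > 0` for a variable `x`. -/
def dutPos (x : DutV) : BExp DutV DutF DutR :=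
  BExp.rel DutR.pos (fun _ => Term.var x)

/-- A constant term. -/
def dutConst (f : DutF) : Term DutV DutF :=
  Term.app f (fun _ => Term.var DutV.p)

/-- The term `p − 1`. -/
def dutPredP : Term DutV DutF :=
  Term.app DutF.pred (fun _ => Term.var DutV.p)

/-- The simultaneous choice `ch_{{1,2}}({x1,x2})`. -/
def dutChoice : Mech DutAg DutV DutF DutR :=
  .choice {0, 1} (by simp) (fun i => if i = 0 then DutV.x1 else DutV.x2)
    (by
      intro a _ b _ hab
      fin_cases a <;> fin_cases b <;> simp_all)

/-- The body of the Dutch-auction while-loop: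
`ch_{{1,2}}({x1,x2}); if x1>0 then w:=1 else (if x2>0 then w:=2 else p:=p−1)`. -/
def dutBody : Mech DutAg DutV DutF DutR :=
  .seq dutChoice
    (.ite (dutPos DutV.x1)
      (.assign DutV.w (dutConst DutF.c1))
      (.ite (dutPos DutV.x2)
        (.assign DutV.w (dutConst DutF.c2))
        (.assign DutV.p dutPredP)))

/-- The loop guard `p > 0 ∧ w = 0`. -/
def dutGuard : BExp DutV DutF DutR :=
  BExp.and (BExp.rel DutR.pos (fun _ => Term.var DutV.p))
    (BExp.rel DutR.zero (fun _ => Term.var DutV.w))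

/-- The Dutch-auction mechanism `α`:
`p:=init; w:=0; while (p>0 ∧ w=0) do (ch_{{1,2}}({x1,x2}); if x1>0 then w:=1 else (if x2>0 then w:=2 else p:=p−1))`. -/
def dutMech : Mech DutAg DutV DutF DutR :=
  .seq (.assign DutV.p (dutConst DutF.cinit))
    (.seq (.assign DutV.w (dutConst DutF.c0))
      (.wh dutGuard dutBody))

/-- The invariant `Inv`:
`v1 ≥ v2 > 0 ∧ p ≥ v2 ∧ w ∈ {0,1,2} ∧ (w=1 → o=(v1−p,0)) ∧ (w=2 → o=(0,v2−p)) ∧ (w=0 → o=(v1−v2,0))`. -/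
def dutInv (v1 v2 init : ℕ) : EPred (dutInterp init) :=
  {so | ∃ pv wv : ℤ, so.1 DutV.p = DutD.int pv ∧ so.1 DutV.w = DutD.int wv ∧
    (v2 : ℤ) ≤ (v1 : ℤ) ∧ 0 < (v2 : ℤ) ∧ (v2 : ℤ) ≤ pv ∧
    (wv = 0 ∨ wv = 1 ∨ wv = 2) ∧
    (wv = 1 → so.2 = DutD.pair ((v1 : ℤ) - pv) 0) ∧
    (wv = 2 → so.2 = DutD.pair 0 ((v2 : ℤ) - pv)) ∧
    (wv = 0 → so.2 = DutD.pair ((v1 : ℤ) - (v2 : ℤ)) 0)}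

/-- The postcondition `Q` of the Dutch auction:
`(w=1 → o=(v1−p,0)) ∧ (w=2 → o=(0,v2−p)) ∧ (w=0 → o=(0,0))`. -/
def dutPost (v1 v2 init : ℕ) : EPred (dutInterp init) :=
  {so | (so.1 DutV.w = DutD.int 1 →
          ∃ pv : ℤ, so.1 DutV.p = DutD.int pv ∧ so.2 = DutD.pair ((v1 : ℤ) - pv) 0) ∧
        (so.1 DutV.w = DutD.int 2 →
          ∃ pv : ℤ, so.1 DutV.p = DutD.int pv ∧ so.2 = DutD.pair 0 ((v2 : ℤ) - pv)) ∧
        (so.1 DutV.w = DutD.int 0 → so.2 = DutD.pair 0 0)}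

/-- The precondition `v1 ≥ v2 > 0 ∧ init ≥ v2 ∧ o = (v1 − v2, 0)`. -/
def dutPre (v1 v2 init : ℕ) : EPred (dutInterp init) :=
  {so | (v2 : ℤ) ≤ (v1 : ℤ) ∧ 0 < (v2 : ℤ) ∧ (v2 : ℤ) ≤ (init : ℤ) ∧
        so.2 = DutD.pair ((v1 : ℤ) - (v2 : ℤ)) 0}

/-- Backward induction for games all of whose plays are finite: if both players follow `strat`
from the configuration, the outcome is the given one, no unilateral deviation is ever profitable,
and every play ends in a state `t` with `(t, out t) ∈ Q`. -/
inductive BackwardInd (I : Interp Ag V F R) (Q : EPred I) (out : State I → I.D)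
    (strat : State I → Ag → I.D) : Cfg I → I.D → Prop where
  | term (s : State I) : (s, out s) ∈ Q → BackwardInd I Q out strat (none, s) (out s)
  | node (γ : Mech Ag V F R) (s : State I) (v : (Ag → I.D) → I.D) :
      (∀ x, BackwardInd I Q out strat (next I (fun a _ => x a) [] γ s) (v x)) →
      (∀ i x, (∀ j, j ≠ i → x j = strat s j) → I.pref i (v (strat s)) (v x)) →
      BackwardInd I Q out strat (some γ, s) (v (strat s))

section General

variable {I : Interp Ag V F R} {Q : EPred I} {out : State I → I.D}
  {strat : State I → Ag → I.D}

theorem updState_self {s : State I} {x : V} (d : I.D) : updState I s x d x = d := if_pos rfl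

theorem updState_ne {s : State I} {x y : V} (d : I.D) (h : y ≠ x) : updState I s x d y = s y :=
  if_neg h

theorem BackwardInd.det {γ : Mech Ag V F R} {s : State I} {c : Cfg I} {d : I.D}
    (hc : ∀ x : Ag → I.D, next I (fun a _ => x a) [] γ s = c)
    (h : BackwardInd I Q out strat c d) : BackwardInd I Q out strat (some γ, s) d :=
  .node γ s (fun _ => d) (fun x => by rw [hc x]; exact h) (fun i _ _ => I.pref_refl i d)

theorem next_eq_next_const (τ : Profile I) (h : List (Cfg I)) (γ : Mech Ag V F R)
    (s : State I) : next I τ h γ s = next I (fun a _ => τ a h) [] γ s := by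
  induction γ generalizing s with
  | assign x t => rfl
  | seq γ1 γ2 ih1 ih2 => rw [next, next, ih1]
  | ite B γ1 γ2 ih1 ih2 => rfl
  | wh B γ ih => rfl
  | choice A hA X hX => rfl

theorem Step.exists_next {c c' : Cfg I} {L : Set Ag} (h : Step I c L c') :
    ∃ γ s, c = (some γ, s) ∧ ∃ x : Ag → I.D, next I (fun a _ => x a) [] γ s = c' := by
  induction h with
  | assign x t s => exact ⟨_, _, rfl, fun _ => I.worst, rfl⟩
  | choice A hA X hX s s' hagree =>
    refine ⟨_, _, rfl, fun a => s' (X a), ?_⟩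
    rw [next]
    congr 1
    funext y
    unfold chooseVal
    split_ifs with hy
    · exact congrArg s' hy.choose_spec.2
    · exact (hagree y fun a ha e => hy ⟨a, ha, e⟩).symm
  | seqFin _ ih =>
    obtain ⟨γ, s, e, x, hx⟩ := ih
    cases e
    exact ⟨_, _, rfl, x, by rw [next, hx]⟩
  | seqStep _ ih =>
    obtain ⟨γ, s, e, x, hx⟩ := ih
    cases e
    exact ⟨_, _, rfl, x, by rw [next, hx]⟩
  | iteT hB => exact ⟨_, _, rfl, fun _ => I.worst, by rw [next, if_pos hB]⟩
  | iteF hB => exact ⟨_, _, rfl, fun _ => I.worst, by rw [next, if_neg hB]⟩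
  | whF hB => exact ⟨_, _, rfl, fun _ => I.worst, by rw [next, if_neg hB]⟩
  | whT hB => exact ⟨_, _, rfl, fun _ => I.worst, by rw [next, if_pos hB]⟩

theorem BackwardInd.exists_of_step {c c' : Cfg I} {L : Set Ag} {d : I.D}
    (h : BackwardInd I Q out strat c d) (hs : Step I c L c') :
    ∃ d', BackwardInd I Q out strat c' d' := by
  obtain ⟨γ, s, rfl, x, rfl⟩ := hs.exists_next
  cases h with
  | node _ _ v hv _ => exact ⟨_, hv x⟩

theorem BackwardInd.exists_of_isHist {h : List (Cfg I)} : ∀ {c c' : Cfg I} {d : I.D},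
    BackwardInd I Q out strat c d → IsHist I c h → h.getLast? = some c' →
    ∃ d', BackwardInd I Q out strat c' d' := by
  induction h with
  | nil => intro c c' d _ _ hl; simp at hl
  | cons a l ih =>
    rintro c c' d hb ⟨h1, h2⟩ hl
    simp only [List.head?_cons, Option.some.injEq] at h1
    subst h1
    cases l with
    | nil =>
      simp only [List.getLast?_singleton, Option.some.injEq] at hl
      subst hl
      exact ⟨d, hb⟩
    | cons b l =>
      obtain ⟨⟨L, hL⟩, h3⟩ := List.isChain_cons_cons.1 h2
      obtain ⟨d', hd'⟩ := hb.exists_of_step hL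
      exact ih hd' ⟨rfl, h3⟩ (by simpa using hl)

theorem IsHist.not_terminal_of_mem_dropLast {h : List (Cfg I)} : ∀ {c : Cfg I},
    IsHist I c h → ∀ x ∈ h.dropLast, x.1 ≠ none := by
  induction h with
  | nil => simp
  | cons a l ih =>
    rintro c ⟨h1, h2⟩ x hx
    cases l with
    | nil => simp at hx
    | cons b l =>
      obtain ⟨⟨L, hL⟩, h3⟩ := List.isChain_cons_cons.1 h2
      rw [List.dropLast_cons_cons, List.mem_cons] at hx
      rcases hx with rfl | hx
      · obtain ⟨γ, s, rfl, _⟩ := hL.exists_next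
        simp
      · exact ih ⟨rfl, h3⟩ x hx

/-- Playing `τ` from the history `h` ends in the final state `t`. -/
def EndsIn (I : Interp Ag V F R) (τ : Profile I) (h : List (Cfg I)) (t : State I) : Prop :=
  ∃ n, ((extend I τ)^[n] h).getLast? = some (none, t)

theorem extend_of_terminal {τ : Profile I} {h : List (Cfg I)} {t : State I}
    (hl : h.getLast? = some (none, t)) : extend I τ h = h := by
  simp [extend, hl]

theorem extend_of_active {τ : Profile I} {h : List (Cfg I)} {γ : Mech Ag V F R} {s : State I}
    (hl : h.getLast? = some (some γ, s)) : extend I τ h = h ++ [next I τ h γ s] := by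
  simp [extend, hl]

theorem EndsIn.unique {τ : Profile I} {h : List (Cfg I)} {t t' : State I}
    (h1 : EndsIn I τ h t) (h2 : EndsIn I τ h t') : t = t' := by
  have key : ∀ (n k : ℕ) (t : State I), ((extend I τ)^[n] h).getLast? = some (none, t) →
      ((extend I τ)^[n + k] h).getLast? = some (none, t) := by
    intro n k t hn
    induction k with
    | zero => exact hn
    | succ k ih => rw [← Nat.add_assoc, Function.iterate_succ_apply', extend_of_terminal ih, ih]
  obtain ⟨n, hn⟩ := h1
  obtain ⟨m, hm⟩ := h2
  have e1 := key n m t hn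
  have e2 := key m n t' hm
  rw [Nat.add_comm, e1] at e2
  simpa using e2

theorem EndsIn.of_extend {τ : Profile I} {h : List (Cfg I)} {γ : Mech Ag V F R} {s t : State I}
    (hl : h.getLast? = some (some γ, s)) (ht : EndsIn I τ (h ++ [next I τ h γ s]) t) :
    EndsIn I τ h t := by
  obtain ⟨n, hn⟩ := ht
  exact ⟨n + 1, by rw [Function.iterate_succ_apply, extend_of_active hl]; exact hn⟩

theorem BackwardInd.exists_endsIn {c : Cfg I} {d : I.D} (hb : BackwardInd I Q out strat c d)
    (τ : Profile I) : ∀ h : List (Cfg I), h.getLast? = some c →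
    ∃ t, EndsIn I τ h t ∧ (t, out t) ∈ Q ∧
      (∀ i, (∀ j, j ≠ i → ∀ h' c', h'.getLast? = some c' → τ j h' = strat c'.2 j) →
        I.pref i d (out t)) ∧
      ((∀ j h' c', h'.getLast? = some c' → τ j h' = strat c'.2 j) → out t = d) := by
  induction hb with
  | term s hQ =>
    intro h hl
    exact ⟨s, ⟨0, hl⟩, hQ, fun i _ => I.pref_refl i _, fun _ => rfl⟩
  | node γ s v _ hnash ih =>
    intro h hl
    have hn := next_eq_next_const τ h γ s
    obtain ⟨t, h1, h2, h3, h4⟩ := ih (fun a => τ a h) (h ++ [next I τ h γ s]) (by simp [← hn])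
    refine ⟨t, h1.of_extend hl, h2, fun i hi => ?_, fun hall => ?_⟩
    · exact I.pref_trans _ _ _ _ (hnash i _ fun j hj => hi j hj h _ hl) (h3 i hi)
    · rw [h4 hall]
      exact congrArg v (funext fun a => hall a h _ hl)

theorem runH_eq_iterate (c : Cfg I) (τ : Profile I) (n : ℕ) :
    runH I c τ n = (extend I τ)^[n] [c] := by
  induction n with
  | zero => rfl
  | succ n ih => rw [runH, ih, Function.iterate_succ_apply']

theorem runH_length_or_terminal (c : Cfg I) (τ : Profile I) (n : ℕ) :
    (runH I c τ n).length ≤ n + 1 ∧ ((runH I c τ n).length = n + 1 ∨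
      ∃ t, (runH I c τ n).getLast? = some (none, t)) := by
  induction n with
  | zero => simp [runH]
  | succ n ih =>
    rw [runH]
    rcases hl : (runH I c τ n).getLast? with _ | ⟨_ | γ, s⟩
    · simp_all [List.getLast?_eq_none_iff]
    · rw [extend_of_terminal hl]
      exact ⟨by omega, Or.inr ⟨s, hl⟩⟩
    · rw [extend_of_active hl]
      simp_all

theorem runOf_terminal_iff {c : Cfg I} {τ : Profile I} {t : State I} :
    (∃ n, runOf I c τ n = some (none, t)) ↔ EndsIn I τ [c] t := by
  simp only [EndsIn, ← runH_eq_iterate]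
  constructor
  · rintro ⟨n, hn⟩
    refine ⟨n, ?_⟩
    rw [runOf] at hn
    obtain ⟨hlt, _⟩ := List.getElem?_eq_some_iff.1 hn
    have := (runH_length_or_terminal c τ n).1
    rw [List.getLast?_eq_getElem?, ← hn]
    congr 1
    omega
  · rintro ⟨n, hn⟩
    induction n with
    | zero => exact ⟨0, by simpa [runOf, runH] using hn⟩
    | succ n ih =>
      rcases hl : (runH I c τ n).getLast? with _ | ⟨_ | γ, s⟩
      · simp [runH, extend, hl] at hn
      · rw [runH, extend_of_terminal hl] at hn
        exact ih hn
      · have hlen : (runH I c τ n).length = n + 1 := by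
          simpa [hl] using (runH_length_or_terminal c τ n).2
        refine ⟨n + 1, ?_⟩
        rw [runH, extend_of_active hl] at hn
        rw [runOf, runH, extend_of_active hl, ← hn, List.getLast?_eq_getElem?]
        simp [hlen]

/-- The outcome function that evaluates `out` at the final state of a finite run. -/
def finalOutcome (I : Interp Ag V F R) (out : State I → I.D) : OutcomeF I :=
  fun ρ => if h : ∃ t : State I, ∃ n, ρ n = some (none, t) then out h.choose else I.worst

theorem finalOutcome_prependRun {c : Cfg I} {τ : Profile I} {t : State I} (l : List (Cfg I))
    (hl : ∀ x ∈ l, x.1 ≠ none) (ht : EndsIn I τ [c] t) :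
    finalOutcome I out (prependRun I l (runOf I c τ)) = out t := by
  have hu : ∀ t', (∃ n, prependRun I l (runOf I c τ) n = some (none, t')) → t' = t := by
    rintro t' ⟨n, hn⟩
    unfold prependRun at hn
    split_ifs at hn with hlt
    · have hm := hl _ (List.getElem_mem hlt)
      simp only [Option.some.injEq] at hn
      simp [hn] at hm
    · exact (runOf_terminal_iff.1 ⟨_, hn⟩).unique ht
  have hex : ∃ t' : State I, ∃ n, prependRun I l (runOf I c τ) n = some (none, t') := by
    obtain ⟨n, hn⟩ := runOf_terminal_iff.2 ht
    exact ⟨t, l.length + n, by simp [prependRun, hn]⟩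
  rw [finalOutcome, dif_pos hex, hu _ hex.choose_spec]

theorem finalOutcome_runOf {c : Cfg I} {τ : Profile I} {t : State I} (ht : EndsIn I τ [c] t) :
    finalOutcome I out (runOf I c τ) = out t := by
  have := finalOutcome_prependRun (out := out) [] (by simp) ht
  rwa [show prependRun I [] (runOf I c τ) = runOf I c τ by funext n; simp [prependRun]] at this

theorem BackwardInd.mem_wpre {γ : Mech Ag V F R} {s : State I} {d : I.D}
    (hb : BackwardInd I Q out strat (some γ, s) d) : (s, d) ∈ wpre I γ Q := by
  let σ : Profile I := fun a h => h.getLast?.elim I.worst fun c => strat c.2 a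
  have hσ : ∀ j h' c', h'.getLast? = some c' → σ j h' = strat c'.2 j := by
    intro j h' c' e
    simp [σ, e]
  refine ⟨finalOutcome I out, σ, ?_, ?_, ?_⟩
  · intro τ hT
    obtain ⟨t, h1, h2, -⟩ := hb.exists_endsIn τ [(some γ, s)] rfl
    obtain ⟨n, hn⟩ : ∃ n, (runH I (some γ, s) τ n).getLast? = some (none, finalState I hT) :=
      ⟨_, hT.choose_spec.choose_spec⟩
    rw [runH_eq_iterate] at hn
    have e : finalState I hT = t := EndsIn.unique ⟨n, hn⟩ h1
    rw [e, finalOutcome_runOf h1]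
    exact h2
  · intro h c hh hl i τ hτ
    obtain ⟨d', hd'⟩ := hb.exists_of_isHist hh hl
    have hr : ∀ j h' c', h'.getLast? = some c' → restrictP I h σ j h' = strat c'.2 j := by
      intro j h' c' e
      exact hσ j _ c' (by simp [e])
    obtain ⟨t, h1, -, -, h4⟩ := hd'.exists_endsIn (restrictP I h σ) [c] rfl
    obtain ⟨t', h1', -, h3', -⟩ := hd'.exists_endsIn τ [c] rfl
    have hne := hh.not_terminal_of_mem_dropLast
    rw [restrictO, restrictO, finalOutcome_prependRun _ hne h1, finalOutcome_prependRun _ hne h1',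
      h4 hr]
    exact h3' i fun j hj h' c' e => by rw [hτ j hj]; exact hr j h' c' e
  · obtain ⟨t, h1, -, -, h4⟩ := hb.exists_endsIn σ [(some γ, s)] rfl
    rw [finalOutcome_runOf h1, h4 hσ]

end General

/-- `d` is a positive integer, i.e. a bid. -/
def dutIsPos (d : DutD) : Prop := ∃ n : ℤ, d = DutD.int n ∧ 0 < n

/-- The equilibrium outcome of the subgame in which the object is unsold at price `p`. -/
def dutVal (v1 v2 p : ℤ) : DutD :=
  if v2 < p then .pair (v1 - v2) 0 else if 0 < p then .pair (v1 - p) 0 else .pair 0 0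

/-- The outcome when the players choose `a` and `b` at price `p` and then play the
equilibrium. -/
def dutRound (v1 v2 p : ℤ) (a b : DutD) : DutD :=
  if dutIsPos a then .pair (v1 - p) 0 else
    if dutIsPos b then .pair 0 (v2 - p) else dutVal v1 v2 (p - 1)

/-- The equilibrium choice of either player at price `p`. -/
def dutBid (v2 p : ℤ) : DutD := if p ≤ v2 then .int 1 else .int 0

/-- The equilibrium outcome given the price `p` and the winner `w`. -/
def dutOut (v1 v2 p w : ℤ) : DutD :=
  if w = 1 then .pair (v1 - p) 0 else if w = 2 then .pair 0 (v2 - p) else dutVal v1 v2 p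

theorem dutIsPos_dutBid {v2 p : ℤ} : dutIsPos (dutBid v2 p) ↔ p ≤ v2 := by
  unfold dutIsPos dutBid
  split_ifs with h <;> simp [h]

theorem dutRound_dutBid {v1 v2 p : ℤ} (h2 : 0 < v2) (hp : 0 < p) :
    dutRound v1 v2 p (dutBid v2 p) (dutBid v2 p) = dutVal v1 v2 p := by
  unfold dutRound dutVal
  simp only [dutIsPos_dutBid]
  split_ifs <;> simp <;> omega

theorem dutPref_dutRound_left {v1 v2 p : ℤ} (h12 : v2 ≤ v1) (hp : 0 < p) (a : DutD) :
    dutPref 0 (dutVal v1 v2 p) (dutRound v1 v2 p a (dutBid v2 p)) := by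
  unfold dutRound dutVal
  simp only [dutIsPos_dutBid]
  right
  split_ifs <;> simp [dutProj] <;> omega

theorem dutPref_dutRound_right {v1 v2 p : ℤ} (hp : 0 < p) (b : DutD) :
    dutPref 1 (dutVal v1 v2 p) (dutRound v1 v2 p (dutBid v2 p) b) := by
  unfold dutRound dutVal
  simp only [dutIsPos_dutBid]
  right
  split_ifs <;> simp [dutProj] <;> omega

/-- Both players bid as soon as the price has dropped to `v2`. -/
def dutStrat (v2 : ℤ) (s : DutV → DutD) (_ : DutAg) : DutD :=
  match s .p with
  | .int n => dutBid v2 n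
  | _ => .bot

/-- The state reached from `s` by the choices `x 0` of `x1` and `x 1` of `x2`. -/
def dutChosen (s : DutV → DutD) (x : DutAg → DutD) : DutV → DutD
  | .p => s .p
  | .w => s .w
  | .x1 => x 0
  | .x2 => x 1

theorem next_dutChoice {init : ℕ} (τ : Profile (dutInterp init))
    (h : List (Cfg (dutInterp init))) (s : State (dutInterp init)) :
    next (dutInterp init) τ h dutChoice s = (none, dutChosen s fun a => τ a h) := by
  refine congrArg (Prod.mk none) ?_
  funext y
  unfold chooseVal
  split_ifs with hy
  · have hc := hy.choose_spec.2
    generalize hy.choose = a at hc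
    fin_cases a <;> simp at hc <;> subst hc <;> rfl
  · cases y
    · rfl
    · rfl
    · exact absurd ⟨0, by simp, by simp⟩ hy
    · exact absurd ⟨1, by simp, by simp⟩ hy

theorem next_seq_dutBody {init : ℕ} (τ : Profile (dutInterp init))
    (h : List (Cfg (dutInterp init))) (γ : Mech DutAg DutV DutF DutR)
    (s : State (dutInterp init)) :
    next (dutInterp init) τ h (.seq dutBody γ) s =
      (some (.seq (.ite (dutPos DutV.x1) (.assign DutV.w (dutConst DutF.c1))
        (.ite (dutPos DutV.x2) (.assign DutV.w (dutConst DutF.c2)) (.assign DutV.p dutPredP))) γ),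
        dutChosen s fun a => τ a h) := by
  rw [dutBody, next, next, next_dutChoice]
  rfl

theorem dutRound_nash {v1 v2 p : ℤ} (h12 : v2 ≤ v1) (hp : 0 < p) {s : DutV → DutD}
    (hs : s .p = .int p) (i : DutAg) (x : DutAg → DutD)
    (hx : ∀ j, j ≠ i → x j = dutStrat v2 s j) :
    dutPref i (dutVal v1 v2 p) (dutRound v1 v2 p (x 0) (x 1)) := by
  fin_cases i
  · have := hx 1 (by simp)
    simp only [dutStrat, hs] at this
    rw [this]
    exact dutPref_dutRound_left h12 hp _
  · have := hx 0 (by simp)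
    simp only [dutStrat, hs] at this
    rw [this]
    exact dutPref_dutRound_right hp _

theorem backwardInd_of_round {init : ℕ} {v1 v2 p : ℤ} {Q : EPred (dutInterp init)}
    {out : State (dutInterp init) → DutD} {γ : Mech DutAg DutV DutF DutR}
    {s : State (dutInterp init)} (h12 : v2 ≤ v1) (h2 : 0 < v2) (hp : 0 < p) (hs : s .p = DutD.int p)
    (h : ∀ x : DutAg → DutD, BackwardInd (dutInterp init) Q out (dutStrat v2)
      (next (dutInterp init) (fun a _ => x a) [] γ s) (dutRound v1 v2 p (x 0) (x 1))) :
    BackwardInd (dutInterp init) Q out (dutStrat v2) (some γ, s) (dutVal v1 v2 p) := by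
  have e : dutRound v1 v2 p (dutStrat v2 s 0) (dutStrat v2 s 1) = dutVal v1 v2 p := by
    simp only [dutStrat, hs]
    exact dutRound_dutBid h2 hp
  have := BackwardInd.node (I := dutInterp init) (Q := Q) (out := out) (strat := dutStrat v2)
    γ s (fun x => dutRound v1 v2 p (x 0) (x 1)) h fun i x hx => by
      rw [e]
      exact dutRound_nash h12 hp hs i x hx
  rwa [e] at this

theorem holds_dutPos {init : ℕ} (s : State (dutInterp init)) (x : DutV) :
    (dutPos x).holds (dutInterp init) s ↔ dutIsPos (s x) := Iff.rfl

theorem holds_dutGuard {init : ℕ} (s : State (dutInterp init)) :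
    dutGuard.holds (dutInterp init) s ↔ dutIsPos (s .p) ∧ s .w = DutD.int 0 := Iff.rfl

theorem eval_dutPredP {init : ℕ} {s : State (dutInterp init)} {n : ℤ} (hs : s .p = DutD.int n) :
    dutPredP.eval (dutInterp init) s = DutD.int (n - 1) := by
  simp [dutPredP, Term.eval, dutInterp, hs]

/-- The loop invariant of the Dutch auction, covering also prices below `v2`, which are
reached off the equilibrium path. -/
def dutLoopInv (v1 v2 init : ℕ) : EPred (dutInterp init) :=
  {so | v2 ≤ v1 ∧ 0 < v2 ∧ ∃ pv wv : ℤ, so.1 .p = DutD.int pv ∧ so.1 .w = DutD.int wv ∧ 0 ≤ pv ∧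
    so.2 = dutOut v1 v2 pv wv}

/-- The assertion holding in the loop body right after the players' choices. -/
def dutMid (v1 v2 init : ℕ) : EPred (dutInterp init) :=
  {so | v2 ≤ v1 ∧ 0 < v2 ∧ ∃ pv : ℤ, so.1 .p = DutD.int pv ∧ so.1 .w = DutD.int 0 ∧ 0 < pv ∧
    so.2 = dutRound v1 v2 pv (so.1 .x1) (so.1 .x2)}

theorem gate_dutLoopInv_subset (v1 v2 init : ℕ) :
    gate (dutInterp init) dutGuard (dutLoopInv v1 v2 init) ⊆
      wpre (dutInterp init) dutChoice (dutMid v1 v2 init) := by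
  rintro ⟨s, o⟩ ⟨⟨h12, h2, pv, wv, hp, hw, h0, ho⟩, hg⟩
  obtain ⟨⟨n, hn, hpos⟩, hw0⟩ := (holds_dutGuard s).1 hg
  simp only at hp hw ho hn hw0
  obtain rfl : pv = n := by
    rw [hp] at hn
    exact DutD.int.inj hn
  obtain rfl : wv = 0 := by
    rw [hw] at hw0
    exact DutD.int.inj hw0
  subst ho
  have e : dutOut v1 v2 pv 0 = dutVal v1 v2 pv := by simp [dutOut]
  rw [e]
  refine BackwardInd.mem_wpre (out := fun t => dutRound v1 v2 pv (t .x1) (t .x2))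
    (backwardInd_of_round (by exact_mod_cast h12) (by exact_mod_cast h2) hpos hp fun x => ?_)
  erw [next_dutChoice]
  exact .term (I := dutInterp init) (out := fun t => dutRound v1 v2 pv (t .x1) (t .x2))
    (dutChosen s x) ⟨h12, h2, pv, hp, hw, hpos, rfl⟩

theorem deriv_dutBody (v1 v2 init : ℕ) :
    Deriv (dutInterp init) (gate (dutInterp init) dutGuard (dutLoopInv v1 v2 init)) dutBody
      (dutLoopInv v1 v2 init) := by
  refine .comp (R' := dutMid v1 v2 init)
    (.conseq (gate_dutLoopInv_subset v1 v2 init) (.choice _ _ _ _ _) subset_rfl)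
    (.ifR (.conseq ?_ (.assign _ _ _) subset_rfl)
      (.ifR (.conseq ?_ (.assign _ _ _) subset_rfl) (.conseq ?_ (.assign _ _ _) subset_rfl)))
  · rintro ⟨s, o⟩ ⟨⟨h12, h2, pv, hp, hw, hpos, ho⟩, hx⟩
    refine ⟨h12, h2, pv, 1, (updState_ne _ (by decide)).trans hp, updState_self _, hpos.le, ?_⟩
    rw [holds_dutPos] at hx
    exact ho.trans (if_pos hx)
  · rintro ⟨s, o⟩ ⟨⟨⟨h12, h2, pv, hp, hw, hpos, ho⟩, hx⟩, hy⟩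
    refine ⟨h12, h2, pv, 2, (updState_ne _ (by decide)).trans hp, updState_self _, hpos.le, ?_⟩
    rw [holds_dutPos] at hx hy
    exact ho.trans ((if_neg hx).trans (if_pos hy))
  · rintro ⟨s, o⟩ ⟨⟨⟨h12, h2, pv, hp, hw, hpos, ho⟩, hx⟩, hy⟩
    refine ⟨h12, h2, pv - 1, 0, ?_, (updState_ne _ (by decide)).trans hw, by omega, ?_⟩
    · exact (updState_self _).trans (eval_dutPredP hp)
    rw [holds_dutPos] at hx hy
    exact ho.trans ((if_neg hx).trans (if_neg hy))

theorem mem_dutPost {v1 v2 init : ℕ} {s : State (dutInterp init)} {pv wv : ℤ}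
    (hp : s .p = DutD.int pv) (hw : s .w = DutD.int wv) (h0 : wv = 0 → pv = 0) :
    (s, dutOut v1 v2 pv wv) ∈ dutPost v1 v2 init := by
  have inj : ∀ n, s .w = DutD.int n → wv = n := by
    intro n hn
    rw [hw] at hn
    exact DutD.int.inj hn
  refine ⟨fun h => ⟨pv, hp, ?_⟩, fun h => ⟨pv, hp, ?_⟩, fun h => ?_⟩
  · simp [dutOut, inj _ h]; rfl
  · simp [dutOut, inj _ h]; rfl
  · have hn : ¬ ((v2 : ℤ) < 0) := by omega
    simp [dutOut, inj _ h, h0 (inj _ h), dutVal, hn]; rfl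

theorem dutVal_of_le {v1 v2 p : ℤ} (h2 : 0 < v2) (hp : v2 ≤ p) :
    dutVal v1 v2 p = .pair (v1 - v2) 0 := by
  unfold dutVal
  split_ifs <;> simp <;> omega

theorem deriv_dutMech (v1 v2 init : ℕ) :
    Deriv (dutInterp init) (dutPre v1 v2 init) dutMech (dutPost v1 v2 init) := by
  have hwh := Deriv.whileR (deriv_dutBody v1 v2 init)
  refine .conseq ?_ (.comp (.assign _ _ _) (.comp (.assign _ _ _) hwh)) ?_
  · rintro ⟨s, o⟩ ⟨h12, h2, hi, ho⟩
    refine ⟨by exact_mod_cast h12, by exact_mod_cast h2, init, 0, (updState_ne _ (by decide)).trans (updState_self _), updState_self _, by omega, ?_⟩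
    exact ho.trans (dutVal_of_le h2 hi).symm
  · rintro ⟨s, o⟩ ⟨⟨h12, h2, pv, wv, hp, hw, h0, ho⟩, hg⟩
    simp only at hp hw ho
    subst ho
    refine mem_dutPost hp hw fun h => ?_
    by_contra hne
    exact hg ((holds_dutGuard s).2 ⟨⟨pv, hp, by omega⟩, by rw [hw, h]⟩)

/-- `dutOut` evaluated at a state. -/
def dutStateOut (v1 v2 : ℤ) (s : DutV → DutD) : DutD :=
  match s .p, s .w with
  | .int pv, .int wv => dutOut v1 v2 pv wv
  | _, _ => .bot

theorem backwardInd_loop_exit {v1 v2 init : ℕ} {s : State (dutInterp init)} {pv wv : ℤ}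
    (hp : s .p = DutD.int pv) (hw : s .w = DutD.int wv) (h0 : wv ≠ 0 ∨ pv = 0) :
    BackwardInd (dutInterp init) (dutPost v1 v2 init) (dutStateOut v1 v2) (dutStrat v2)
      (some (.wh dutGuard dutBody), s) (dutOut v1 v2 pv wv) := by
  have e : dutStateOut v1 v2 s = dutOut v1 v2 pv wv := by simp [dutStateOut, hp, hw]
  refine .det (c := (none, s)) (fun x => ?_) ?_
  · rw [next, if_neg]
    rw [holds_dutGuard]
    rintro ⟨⟨n, hn, hpos⟩, hw0⟩
    rw [hp] at hn
    rw [hw] at hw0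
    have := DutD.int.inj hn
    have := DutD.int.inj hw0
    omega
  · have h := mem_dutPost (v1 := v1) (v2 := v2) hp hw (by omega)
    rw [← e] at h ⊢
    exact .term s h

theorem backwardInd_loop {v1 v2 init : ℕ} (h12 : v2 ≤ v1) (h2 : 0 < v2) (n : ℕ) :
    ∀ s : State (dutInterp init), s .p = DutD.int n → s .w = DutD.int 0 →
    BackwardInd (dutInterp init) (dutPost v1 v2 init) (dutStateOut v1 v2) (dutStrat v2)
      (some (.wh dutGuard dutBody), s) (dutVal v1 v2 n) := by
  induction n with
  | zero =>
    intro s hp hw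
    simpa [dutOut] using backwardInd_loop_exit (v1 := v1) (v2 := v2) hp hw (Or.inr rfl)
  | succ n ih =>
    intro s hp hw
    have hpos : (0 : ℤ) < (n + 1 : ℕ) := by omega
    have hg : dutGuard.holds (dutInterp init) s := (holds_dutGuard s).2 ⟨⟨_, hp, hpos⟩, hw⟩
    refine .det (fun x => by rw [next, if_pos hg]) (backwardInd_of_round
      (by exact_mod_cast h12) (by exact_mod_cast h2) hpos hp fun x => ?_)
    erw [next_seq_dutBody]
    set t : State (dutInterp init) := dutChosen s x
    have htp : t .p = DutD.int (n + 1 : ℕ) := hp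
    have htw : t .w = DutD.int 0 := hw
    unfold dutRound
    split_ifs with hx hy
    · refine .det (fun y => by rw [next, next, if_pos ((holds_dutPos t .x1).2 hx)])
        (.det (fun y => by rw [next, next]) ?_)
      exact backwardInd_loop_exit (wv := 1) ((updState_ne _ (by decide)).trans htp) (updState_self _) (Or.inl one_ne_zero)
    · refine .det (fun y => by rw [next, next, if_neg (mt (holds_dutPos t .x1).1 hx)])
        (.det (fun y => by rw [next, next, if_pos ((holds_dutPos t .x2).2 hy)])
        (.det (fun y => by rw [next, next]) ?_))
      exact backwardInd_loop_exit (wv := 2) ((updState_ne _ (by decide)).trans htp) (updState_self _) (Or.inl two_ne_zero)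
    · refine .det (fun y => by rw [next, next, if_neg (mt (holds_dutPos t .x1).1 hx)])
        (.det (fun y => by rw [next, next, if_neg (mt (holds_dutPos t .x2).1 hy)])
        (.det (fun y => by rw [next, next]) ?_))
      have e : (((n + 1 : ℕ) : ℤ) - 1) = n := by simp
      rw [e]
      refine ih _ ?_ ((updState_ne _ (by decide)).trans htw)
      exact (updState_self _).trans (by simpa using eval_dutPredP htp)

/-- Verification of the Dutch auction:
`I ⊢ {v1 ≥ v2 > 0 ∧ init ≥ v2 ∧ o=(v1−v2,0)} α {Q}`; in particular, whenever
`v1 ≥ v2 > 0` and `init ≥ v2`, the Dutch auction has a subgame-perfect equilibrium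
yielding the outcome `(v1 − v2, 0)`. -/
theorem dutch_verification (v1 v2 init : ℕ) :
    Deriv (dutInterp init) (dutPre v1 v2 init) dutMech (dutPost v1 v2 init) ∧
    (v2 ≤ v1 → 0 < v2 → v2 ≤ init →
      ∀ s : State (dutInterp init), ∃ (oh : OutcomeF (dutInterp init))
        (σ : Profile (dutInterp init)),
        memOhat (dutInterp init) (some dutMech, s) (dutPost v1 v2 init) oh ∧
        SPE (dutInterp init) dutMech s oh σ ∧
        oh (runOf (dutInterp init) (some dutMech, s) σ) =
          DutD.pair ((v1 : ℤ) - (v2 : ℤ)) 0) := by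
  refine ⟨deriv_dutMech v1 v2 init, fun h12 h2 hi s => ?_⟩
  rw [← dutVal_of_le (v1 := v1) (p := init) (by exact_mod_cast h2) (by exact_mod_cast hi)]
  have h := backwardInd_loop h12 h2 init (updState (dutInterp init)
    (updState (dutInterp init) s .p (DutD.int init)) .w (DutD.int 0))
    ((updState_ne _ (by decide)).trans (updState_self _)) (updState_self _)
  refine BackwardInd.mem_wpre (γ := dutMech) (.det
    (c := (some (.seq (.assign .w (dutConst .c0)) (.wh dutGuard dutBody)),
      updState (dutInterp init) s .p (DutD.int init)))
    (fun x => ?_) (.det (fun x => ?_) h))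
  · rw [dutMech, next, next]
    rfl
  · rw [next, next]
    rfl

end MPL
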